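/- arXiv:math/0410311 — 2 statements merged into one kernel-verified Lean document; each statement's English description precedes it below -/
import Mathlib

section
/- Let ∼ be a closed equivalence relation on the set R of rays of T'_m, let 0≤p≤1, let q≥1, and let φ∈R^∼_{p,q}. Then φ_π ≤st φ ≤st φ^{1,∼}_{p,q} ≤st φ¹_{p,q}, where ≤st denotes stochastic ordering. -/
namespace RCTree

abbrev Edge (m : ℕ) := Fin (m + 1) × List (Fin m)
abbrev V (m : ℕ) := Option (Edge m)
abbrev Ray (m : ℕ) := Fin (m + 1) × (ℕ → Fin m)
abbrev Config (m : ℕ) := Edge m → Bool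

variable {m : ℕ}

/-- The vertex at the top (towards the root) of an edge. -/
def parentV (e : Edge m) : V m :=
  if e.2 = [] then none else some (e.1, e.2.dropLast)

/-- The vertex at the bottom (away from the root) of an edge. -/
def childV (e : Edge m) : V m := some e

/-- The (undirected) edge `e` has endvertices `u` and `v`. -/
def EndsAt (e : Edge m) (u v : V m) : Prop :=
  (parentV e = u ∧ childV e = v) ∨ (parentV e = v ∧ childV e = u)

/-- The `n`-th edge of a ray from the root. -/
def rayEdge (ρ : Ray m) (n : ℕ) : Edge m := (ρ.1, List.ofFn fun k : Fin n => ρ.2 k)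

/-- The `n`-th vertex of a ray from the root. -/
def rayVtx (ρ : Ray m) : ℕ → V m
  | 0 => none
  | n + 1 => some (rayEdge ρ n)

def rayEdges (ρ : Ray m) : Set (Edge m) := Set.range (rayEdge ρ)

/-- The ray `ρ` passes through the vertex `v`. -/
def RayThrough (ρ : Ray m) (v : V m) : Prop := ∃ n, rayVtx ρ n = v

/-- All edges of the ray `ρ` are open in `ω`. -/
def OpenRay (ω : Config m) (ρ : Ray m) : Prop := ∀ n, ω (rayEdge ρ n) = true

/-- An infinite self-avoiding (undirected) path with endpoint `x`. -/
structure IPath (m : ℕ) (x : V m) where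
  vtx : ℕ → V m
  start : vtx 0 = x
  inj : Function.Injective vtx
  adj : ∀ n, ∃ e : Edge m, EndsAt e (vtx n) (vtx (n + 1))

/-- The edges traversed by an infinite path. -/
def IPath.edges {x : V m} (π : IPath m x) : Set (Edge m) :=
  {e | ∃ n, EndsAt e (π.vtx n) (π.vtx (n + 1))}

/-- A path is forward (an `x`-ray) if it is directed away from the root. -/
def IPath.Forward {x : V m} (π : IPath m x) : Prop :=
  ∀ n, ∃ e : Edge m, parentV e = π.vtx n ∧ childV e = π.vtx (n + 1)

/-- All edges of the path `π` are open in `ω`. -/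
def OpenPath {x : V m} (ω : Config m) (π : IPath m x) : Prop :=
  ∀ e ∈ π.edges, ω e = true

/-- The path `π` and the `0`-ray `ρ` differ in only finitely many edges:
`ρ` is the `0`-ray associated with `π`. -/
def Assoc {x : V m} (π : IPath m x) (ρ : Ray m) : Prop :=
  ((IPath.edges π \ rayEdges ρ) ∪ (rayEdges ρ \ IPath.edges π)).Finite

/-- The set of edges with both endvertices in `Λ`. -/
def ELam (Λ : Set (V m)) : Set (Edge m) :=
  {e | parentV e ∈ Λ ∧ childV e ∈ Λ}

/-- The event `K^S_{u,v,Λ}`: there exist vertex-disjoint open infinite paths from `u` and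
from `v`, edge-disjoint from `E_Λ`, whose associated `0`-rays are `S`-related. -/
def KEvent (S : Ray m → Ray m → Prop) (Λ : Set (V m)) (u v : V m) : Set (Config m) :=
  {ω | ∃ (πu : IPath m u) (πv : IPath m v),
      (∀ a b, πu.vtx a ≠ πv.vtx b) ∧
      OpenPath ω πu ∧ OpenPath ω πv ∧
      (∀ e ∈ πu.edges, e ∉ ELam Λ) ∧ (∀ e ∈ πv.edges, e ∉ ELam Λ) ∧
      ∃ ρu ρv : Ray m, Assoc πu ρu ∧ Assoc πv ρv ∧ S ρu ρv}

/-- The event `A^S_{u,v}`: there exist open `u`- and `v`-rays whose associated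
`0`-rays are `S`-related. -/
def AEvent (S : Ray m → Ray m → Prop) (u v : V m) : Set (Config m) :=
  {ω | ∃ (πu : IPath m u) (πv : IPath m v),
      πu.Forward ∧ πv.Forward ∧ OpenPath ω πu ∧ OpenPath ω πv ∧
      ∃ ρu ρv : Ray m, Assoc πu ρu ∧ Assoc πv ρv ∧ S ρu ρv}

/-- The event `A'^S_{u,v}`: there exist open `0`-rays through `u` and through `v`
that are `S`-related. -/
def APrimeEvent (S : Ray m → Ray m → Prop) (u v : V m) : Set (Config m) :=
  {ω | ∃ ρu ρv : Ray m, RayThrough ρu u ∧ RayThrough ρv v ∧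
      OpenRay ω ρu ∧ OpenRay ω ρv ∧ S ρu ρv}

/-- `u` lies on the (unique) path of the tree from the root to `v` (ancestor-or-equal). -/
def Anc : V m → V m → Prop
  | none, _ => True
  | some _, none => False
  | some e, some f => e.1 = f.1 ∧ e.2 <+: f.2

/-- Two vertices are comparable if one lies on the path from the root to the other. -/
def Comparable (u v : V m) : Prop := Anc u v ∨ Anc v u

/-- `W` is a cutset: it is incomparable (no ray contains more than one member of `W`)
and every ray contains some member of `W`. -/
def IsCutset (W : Set (V m)) : Prop :=
  (∀ (ρ : Ray m) (u v : V m), u ∈ W → v ∈ W → RayThrough ρ u → RayThrough ρ v → u = v) ∧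
  ∀ ρ : Ray m, ∃ v ∈ W, RayThrough ρ v

noncomputable section
open scoped ENNReal
open Classical MeasureTheory

variable {m : ℕ}

/-- The finite set of edges with both endvertices in the finite vertex set `Λ`. -/
def EdgeFinset (Λ : Finset (V m)) : Finset (Edge m) :=
  (Λ.preimage (childV) (Option.some_injective _).injOn).filter fun e => parentV e ∈ Λ

/-- The set `Ω^ξ_Λ` of configurations agreeing with `ξ` off `E_Λ`. -/
def cylinderSet (Λ : Finset (V m)) (ξ : Config m) : Set (Config m) :=
  {ω | ∀ e, e ∉ ELam (↑Λ : Set (V m)) → ω e = ξ e}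

/-- `u` and `v` are joined by an `ω`-open path using no edge of `E_Λ`. -/
def OutConn (Λ : Set (V m)) (ω : Config m) (u v : V m) : Prop :=
  ∃ (n : ℕ) (f : ℕ → V m), f 0 = u ∧ f n = v ∧
    ∀ i < n, ∃ e : Edge m, ω e = true ∧ e ∉ ELam Λ ∧ EndsAt e (f i) (f (i + 1))

/-- The adjacency used to count clusters: open edges of `E_Λ` together with the
augmentation rules (a) and (b). -/
def augRel (S : Ray m → Ray m → Prop) (Λ : Finset (V m)) (ω : Config m) (u v : V m) : Prop :=
  (∃ e ∈ ELam (↑Λ : Set (V m)), ω e = true ∧ EndsAt e u v) ∨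
    OutConn (↑Λ : Set (V m)) ω u v ∨ ω ∈ KEvent S (↑Λ : Set (V m)) u v

/-- The number `k^{ξ,∼}(Λ,ω)` of connected components of the augmented open graph on `Λ`
(for `ω` agreeing with `ξ` off `E_Λ`, the boundary condition is read off from `ω` itself). -/
def kCount (S : Ray m → Ray m → Prop) (Λ : Finset (V m)) (ω : Config m) : ℕ :=
  Nat.card (SimpleGraph.fromRel fun u v : {x // x ∈ Λ} => augRel S Λ ω ↑u ↑v).ConnectedComponent

/-- The random-cluster weight of a configuration. -/
def rcWeight (S : Ray m → Ray m → Prop) (p q : ℝ) (Λ : Finset (V m)) (ω : Config m) : ℝ≥0∞ :=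
  (∏ e ∈ EdgeFinset Λ, ENNReal.ofReal (if ω e then p else 1 - p)) *
    ENNReal.ofReal q ^ kCount S Λ ω

/-- The unnormalised random-cluster measure on `Λ` with boundary condition `ξ`. -/
def rcUnnorm (S : Ray m → Ray m → Prop) (p q : ℝ) (Λ : Finset (V m)) (ξ : Config m) :
    Measure (Config m) :=
  Measure.sum fun ω : {ω : Config m // ω ∈ cylinderSet Λ ξ} =>
    rcWeight S p q Λ (ω : Config m) • Measure.dirac (ω : Config m)

/-- The finite-volume random-cluster measure `φ^{ξ,∼}_{Λ,p,q}`. -/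
def rcFin (S : Ray m → Ray m → Prop) (p q : ℝ) (Λ : Finset (V m)) (ξ : Config m) :
    Measure (Config m) :=
  (rcUnnorm S p q Λ ξ Set.univ)⁻¹ • rcUnnorm S p q Λ ξ

/-- The σ-field `T_Λ` generated by the states of edges not in `E_Λ`. -/
def outSigma (Λ : Finset (V m)) : MeasurableSpace (Config m) :=
  MeasurableSpace.comap (fun ω (e : {e : Edge m // e ∉ EdgeFinset Λ}) => ω ↑e) inferInstance

/-- The set `R^∼_{p,q}` of `(∼)`random-cluster measures: probability measures whose
conditional measure given `T_Λ` at `ξ` is `φ^{ξ,∼}_{Λ,p,q}`, for every finite `Λ`. -/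
def RCSet (S : Ray m → Ray m → Prop) (p q : ℝ) : Set (Measure (Config m)) :=
  {φ | IsProbabilityMeasure φ ∧
    ∀ (Λ : Finset (V m)) (A : Set (Config m)), MeasurableSet A →
      ∀ B : Set (Config m), MeasurableSet[outSigma Λ] B →
        φ (A ∩ B) = ∫⁻ ξ in B, rcFin S p q Λ ξ A ∂φ}

/-- Weak convergence of the finite-volume measures as `Λ ↑ V`. -/
def WeakLim (μs : Finset (V m) → Measure (Config m)) (φ : Measure (Config m)) : Prop :=
  ∀ f : BoundedContinuousFunction (Config m) ℝ,
    Filter.Tendsto (fun Λ => ∫ ω, f ω ∂(μs Λ)) Filter.atTop (nhds (∫ ω, f ω ∂φ))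

/-- `μ` is the Bernoulli product measure with density `r` on the edges. -/
def IsBernoulliProduct (r : ℝ) (μ : Measure (Config m)) : Prop :=
  IsProbabilityMeasure μ ∧
    ∀ (s : Finset (Edge m)) (σ : Config m),
      μ {ω | ∀ e ∈ s, ω e = σ e} = ∏ e ∈ s, ENNReal.ofReal (if σ e then r else 1 - r)

/-- An increasing event. -/
def IncreasingEvent (A : Set (Config m)) : Prop :=
  ∀ ω ω' : Config m, (∀ e, ω e = true → ω' e = true) → ω ∈ A → ω' ∈ A

/-- Stochastic ordering of measures on the configuration space. -/
def StochLE (μ ν : Measure (Config m)) : Prop :=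
  ∀ A : Set (Config m), MeasurableSet A → IncreasingEvent A → μ A ≤ ν A

/-- The wired equivalence relation: all rays are equivalent. -/
def wiredRel (m : ℕ) : Ray m → Ray m → Prop := fun _ _ => True

/-- The all-open boundary configuration. -/
def oneCfg (m : ℕ) : Config m := fun _ => true

/-- `S`, viewed as a subset of `R × R`, is closed. -/
def IsClosedRel (S : Ray m → Ray m → Prop) : Prop :=
  IsClosed {x : Ray m × Ray m | S x.1 x.2}

/-- The closure of the relation `S`: the intersection of all closed equivalence
relations containing `S`. -/
def closureRel (S : Ray m → Ray m → Prop) : Ray m → Ray m → Prop := fun a b =>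
  ∀ T : Ray m → Ray m → Prop, Equivalence T → IsClosedRel T → (∀ x y, S x y → T x y) → T a b

end

open MeasureTheory Filter
open scoped ENNReal

/-! ### Linear-algebraic description of component counts -/

section Components

variable {α : Type*}

/-- The space of rational functions which are constant along the relation `r`. -/
def locallyConstant (r : α → α → Prop) : Submodule ℚ (α → ℚ) where
  carrier := {f | ∀ u v, r u v → f u = f v}
  add_mem' := fun {f g} hf hg u v h => by simp [hf u v h, hg u v h]
  zero_mem' := fun _ _ _ => rfl
  smul_mem' := fun c f hf u v h => by simp [hf u v h]

lemma mem_locallyConstant {r : α → α → Prop} {f : α → ℚ} :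
    f ∈ locallyConstant r ↔ ∀ u v, r u v → f u = f v := Iff.rfl

lemma finrank_locallyConstant [Finite α] (r : α → α → Prop) :
    Module.finrank ℚ (locallyConstant r) =
      Nat.card (SimpleGraph.fromRel r).ConnectedComponent := by
  classical
  set G := SimpleGraph.fromRel r
  have : Fintype G.ConnectedComponent := Fintype.ofFinite _
  have hsurj : Function.Surjective G.connectedComponentMk := Quot.mk_surjective
  have hrange : LinearMap.range (LinearMap.funLeft ℚ ℚ G.connectedComponentMk) =
      locallyConstant r := by
    ext f
    rw [LinearMap.mem_range, mem_locallyConstant]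
    constructor
    · rintro ⟨g, rfl⟩ u v huv
      by_cases h : u = v
      · rw [h]
      · have : G.Adj u v := ⟨h, Or.inl huv⟩
        simp only [LinearMap.funLeft_apply]
        rw [SimpleGraph.ConnectedComponent.sound this.reachable]
    · intro hf
      refine ⟨SimpleGraph.ConnectedComponent.lift f ?_, rfl⟩
      intro u v w _
      induction w with
      | nil => rfl
      | cons h w ih =>
        rename_i hp
        rw [← ih (by simp_all)]
        rcases h.2 with h | h
        · exact hf _ _ h
        · exact (hf _ _ h).symm
  rw [← hrange, LinearMap.finrank_range_of_inj
    (LinearMap.funLeft_injective_of_surjective ℚ ℚ _ hsurj), Module.finrank_fintype_fun_eq_card,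
    Nat.card_eq_fintype_card]

lemma finrank_locallyConstant_add_le [Finite α] {r s i t : α → α → Prop}
    (ht : ∀ u v, t u v → r u v ∨ s u v) (hr : ∀ u v, i u v → r u v)
    (hs : ∀ u v, i u v → s u v) :
    Module.finrank ℚ (locallyConstant r) + Module.finrank ℚ (locallyConstant s) ≤
      Module.finrank ℚ (locallyConstant i) + Module.finrank ℚ (locallyConstant t) := by
  rw [← Submodule.finrank_sup_add_finrank_inf_eq]
  refine add_le_add (Submodule.finrank_mono (sup_le ?_ ?_)) (Submodule.finrank_mono ?_)
  · exact fun f hf u v h => hf u v (hr u v h)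
  · exact fun f hf u v h => hf u v (hs u v h)
  · exact fun f hf u v h => (ht u v h).elim (hf.1 u v) (hf.2 u v)

lemma finrank_locallyConstant_le_add_card [Finite α] {ι : Type*} [Fintype ι] (x y : ι → α)
    {r s : α → α → Prop}
    (h : ∀ u v, s u v → r u v ∨ ∃ j, (x j = u ∧ y j = v) ∨ (x j = v ∧ y j = u)) :
    Module.finrank ℚ (locallyConstant r) ≤
      Module.finrank ℚ (locallyConstant s) + Fintype.card ι := by
  let T : locallyConstant r →ₗ[ℚ] (ι → ℚ) :=
    (LinearMap.funLeft ℚ ℚ x - LinearMap.funLeft ℚ ℚ y).comp (locallyConstant r).subtype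
  have hker : Module.finrank ℚ (LinearMap.ker T) ≤ Module.finrank ℚ (locallyConstant s) := by
    rw [← Submodule.finrank_map_subtype_eq]
    refine Submodule.finrank_mono ?_
    rintro _ ⟨f, hf, rfl⟩ u v huv
    have hT : ∀ j, f.1 (x j) = f.1 (y j) := fun j => by
      simpa [T, LinearMap.funLeft_apply, sub_eq_zero] using congrFun (LinearMap.mem_ker.1 hf) j
    rcases h u v huv with h | ⟨j, ⟨rfl, rfl⟩ | ⟨rfl, rfl⟩⟩
    · exact f.2 u v h
    · exact hT j
    · exact (hT j).symm
  have hrange : Module.finrank ℚ (LinearMap.range T) ≤ Fintype.card ι := by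
    simpa using Submodule.finrank_le (LinearMap.range T)
  have := T.finrank_range_add_finrank_ker
  omega

end Components

/-! ### Cluster counts -/

lemma mem_EdgeFinset {Λ : Finset (V m)} {e : Edge m} :
    e ∈ EdgeFinset Λ ↔ e ∈ ELam (↑Λ : Set (V m)) := by
  have hpre : e ∈ Λ.preimage childV (Option.some_injective _).injOn ↔ childV e ∈ Λ :=
    Finset.mem_preimage
  rw [EdgeFinset, Finset.mem_filter]
  exact (and_congr_left' hpre).trans and_comm

lemma kCount_eq_finrank (S : Ray m → Ray m → Prop) (Λ : Finset (V m)) (ω : Config m) :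
    kCount S Λ ω = Module.finrank ℚ
      (locallyConstant fun u v : {x // x ∈ Λ} => augRel S Λ ω ↑u ↑v) :=
  (finrank_locallyConstant _).symm

lemma OutConn.mono {Λ : Set (V m)} {ω ω' : Config m} {u v : V m}
    (h : ∀ e, e ∉ ELam Λ → ω e = true → ω' e = true) (huv : OutConn Λ ω u v) :
    OutConn Λ ω' u v := by
  obtain ⟨n, f, h0, hn, hf⟩ := huv
  refine ⟨n, f, h0, hn, fun i hi => ?_⟩
  obtain ⟨e, he, heΛ, hends⟩ := hf i hi
  exact ⟨e, h e heΛ he, heΛ, hends⟩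

lemma KEvent_mono {S T : Ray m → Ray m → Prop} (hST : ∀ x y, S x y → T x y)
    {Λ : Set (V m)} {ω ω' : Config m} {u v : V m}
    (h : ∀ e, e ∉ ELam Λ → ω e = true → ω' e = true) (hω : ω ∈ KEvent S Λ u v) :
    ω' ∈ KEvent T Λ u v := by
  obtain ⟨πu, πv, hdis, hu, hv, hu', hv', ρu, ρv, hau, hav, hS⟩ := hω
  exact ⟨πu, πv, hdis, fun e he => h e (hu' e he) (hu e he),
    fun e he => h e (hv' e he) (hv e he), hu', hv', ρu, ρv, hau, hav, hST _ _ hS⟩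

lemma augRel_mono {S T : Ray m → Ray m → Prop} (hST : ∀ x y, S x y → T x y)
    {Λ : Finset (V m)} {ω ω' : Config m} (h : ∀ e, ω e = true → ω' e = true) {u v : V m}
    (huv : augRel S Λ ω u v) : augRel T Λ ω' u v := by
  rcases huv with ⟨e, he, ho, hends⟩ | huv | huv
  · exact Or.inl ⟨e, he, h e ho, hends⟩
  · exact Or.inr (Or.inl (huv.mono fun e _ => h e))
  · exact Or.inr (Or.inr (KEvent_mono hST (fun e _ => h e) huv))

lemma kCount_add_le {S T : Ray m → Ray m → Prop} (hST : ∀ x y, S x y → T x y)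
    (Λ : Finset (V m)) {ω ω' : Config m}
    (h : ∀ e, e ∉ ELam (↑Λ : Set (V m)) → ω e = true → ω' e = true) :
    kCount S Λ ω + kCount T Λ ω' ≤ kCount S Λ (ω ⊓ ω') + kCount T Λ (ω ⊔ ω') := by
  simp only [kCount_eq_finrank]
  refine finrank_locallyConstant_add_le (fun u v huv => ?_)
    (fun u v => augRel_mono (fun _ _ h => h) fun e he => ?_)
    (fun u v => augRel_mono hST fun e he => ?_)
  · have hsup : ∀ e, e ∉ ELam (↑Λ : Set (V m)) → (ω ⊔ ω') e = true → ω' e = true := by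
      intro e he ho
      rcases (Bool.or_eq_true _ _).mp ho with ho | ho
      · exact h e he ho
      · exact ho
    rcases huv with ⟨e, he, ho, hends⟩ | huv | huv
    · rcases (Bool.or_eq_true _ _).mp ho with ho | ho
      · exact Or.inl (Or.inl ⟨e, he, ho, hends⟩)
      · exact Or.inr (Or.inl ⟨e, he, ho, hends⟩)
    · exact Or.inr (Or.inr (Or.inl (huv.mono hsup)))
    · exact Or.inr (Or.inr (Or.inr (KEvent_mono (fun _ _ h => h) hsup huv)))
  · exact ((Bool.and_eq_true _ _).mp he).1
  · exact ((Bool.and_eq_true _ _).mp he).2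

lemma kCount_le_add_card (S : Ray m → Ray m → Prop) (Λ : Finset (V m)) {ω ω' : Config m}
    (h : ∀ e, e ∉ ELam (↑Λ : Set (V m)) → ω e = true → ω' e = true) :
    kCount S Λ ω' ≤ kCount S Λ (ω ⊔ ω') +
      ((EdgeFinset Λ).filter fun e => ω e = true ∧ ω' e = false).card := by
  simp only [kCount_eq_finrank]
  rw [← Fintype.card_coe]
  have hmem : ∀ j : {e // e ∈ (EdgeFinset Λ).filter fun e => ω e = true ∧ ω' e = false},
      parentV j.1 ∈ Λ ∧ childV j.1 ∈ Λ := fun j =>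
    mem_EdgeFinset.1 (Finset.mem_filter.1 j.2).1
  refine finrank_locallyConstant_le_add_card (fun j => ⟨parentV j.1, (hmem j).1⟩)
    (fun j => ⟨childV j.1, (hmem j).2⟩) fun u v huv => ?_
  have hsup : ∀ e, e ∉ ELam (↑Λ : Set (V m)) → (ω ⊔ ω') e = true → ω' e = true := by
    intro e he ho
    rcases (Bool.or_eq_true _ _).mp ho with ho | ho
    · exact h e he ho
    · exact ho
  rcases huv with ⟨e, he, ho, hends⟩ | huv | huv
  · by_cases hω' : ω' e = true
    · exact Or.inl (Or.inl ⟨e, he, hω', hends⟩)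
    · have hω : ω e = true := ((Bool.or_eq_true _ _).mp ho).resolve_right hω'
      refine Or.inr ⟨⟨e, Finset.mem_filter.2 ⟨mem_EdgeFinset.2 he, hω, by simpa using hω'⟩⟩, ?_⟩
      simpa [Subtype.ext_iff, EndsAt] using hends
  · exact Or.inl (Or.inr (Or.inl (huv.mono hsup)))
  · exact Or.inl (Or.inr (Or.inr (KEvent_mono (fun _ _ h => h) hsup huv)))

/-! ### Finite-volume measures as finite sums -/

/-- The configuration equal to `a` on `E` and to `ξ` elsewhere. -/
def glue (E : Finset (Edge m)) (ξ : Config m) (a : {e // e ∈ E} → Bool) : Config m :=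
  fun e => if h : e ∈ E then a ⟨e, h⟩ else ξ e

lemma glue_apply_coe {E : Finset (Edge m)} (ξ : Config m) (a : {e // e ∈ E} → Bool)
    (e : {e // e ∈ E}) : glue E ξ a e = a e := by
  simp [glue]

lemma glue_of_notMem {E : Finset (Edge m)} (ξ : Config m) (a : {e // e ∈ E} → Bool)
    {e : Edge m} (he : e ∉ E) : glue E ξ a e = ξ e := by
  simp [glue, he]

lemma glue_restrict (E : Finset (Edge m)) {ξ ω : Config m} (h : ∀ e, e ∉ E → ω e = ξ e) :
    glue E ξ (fun e => ω e) = ω := by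
  funext e
  by_cases he : e ∈ E
  · simp [glue, he]
  · simp [glue, he, h e he]

lemma glue_mono {E : Finset (Edge m)} {ξ ξ' : Config m} {a b : {e // e ∈ E} → Bool}
    (hξ : ∀ e, ξ e = true → ξ' e = true) (hab : a ≤ b) (e : Edge m)
    (h : glue E ξ a e = true) : glue E ξ' b e = true := by
  by_cases he : e ∈ E
  · simp only [glue, he, dif_pos] at h ⊢
    exact hab _ h
  · simp only [glue, he, dif_neg, not_false_eq_true] at h ⊢
    exact hξ e h

/-- The product weight of `ω` on `E`: a factor `x` for each open and `y` for each closed edge. -/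
def edgeWeight (x y : ℝ) (E : Finset (Edge m)) (ω : Config m) : ℝ :=
  ∏ e ∈ E, if ω e then x else y

lemma edgeWeight_nonneg {x y : ℝ} (hx : 0 ≤ x) (hy : 0 ≤ y) (E : Finset (Edge m))
    (ω : Config m) : 0 ≤ edgeWeight x y E ω :=
  Finset.prod_nonneg fun e _ => by split_ifs <;> assumption

lemma edgeWeight_mul (x y : ℝ) (E : Finset (Edge m)) (ω ω' : Config m) :
    edgeWeight x y E ω * edgeWeight x y E ω' =
      edgeWeight x y E (ω ⊓ ω') * edgeWeight x y E (ω ⊔ ω') := by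
  simp only [edgeWeight, ← Finset.prod_mul_distrib]
  refine Finset.prod_congr rfl fun e _ => ?_
  simp only [Pi.inf_apply, Pi.sup_apply]
  rcases Bool.eq_false_or_eq_true (ω e) with h | h <;>
    rcases Bool.eq_false_or_eq_true (ω' e) with h' | h' <;> simp [h, h', mul_comm]

/-- The real-valued random-cluster weight. -/
noncomputable def rcWeightReal (S : Ray m → Ray m → Prop) (p q : ℝ) (Λ : Finset (V m))
    (ω : Config m) : ℝ :=
  edgeWeight p (1 - p) (EdgeFinset Λ) ω * q ^ kCount S Λ ω

section FiniteVolume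

variable {S T : Ray m → Ray m → Prop} {p q : ℝ}

lemma rcWeightReal_nonneg (hp0 : 0 ≤ p) (hp1 : p ≤ 1) (hq : 1 ≤ q) (Λ : Finset (V m))
    (ω : Config m) : 0 ≤ rcWeightReal S p q Λ ω :=
  mul_nonneg (edgeWeight_nonneg hp0 (by linarith) _ _) (pow_nonneg (by linarith) _)

lemma rcWeight_eq_ofReal (hp0 : 0 ≤ p) (hp1 : p ≤ 1) (hq : 1 ≤ q) (Λ : Finset (V m))
    (ω : Config m) : rcWeight S p q Λ ω = ENNReal.ofReal (rcWeightReal S p q Λ ω) := by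
  rw [rcWeight, rcWeightReal, ENNReal.ofReal_mul (edgeWeight_nonneg hp0 (by linarith) _ _),
    ENNReal.ofReal_pow (by linarith), edgeWeight, ENNReal.ofReal_prod_of_nonneg]
  intro e _
  split_ifs <;> linarith

/-- Configurations agreeing with `ξ` off `E_Λ` are given by their restriction to `E_Λ`. -/
noncomputable def cylinderEquiv (Λ : Finset (V m)) (ξ : Config m) :
    ({e // e ∈ EdgeFinset Λ} → Bool) ≃ {ω : Config m // ω ∈ cylinderSet Λ ξ} where
  toFun a := ⟨glue (EdgeFinset Λ) ξ a,
    fun _ he => glue_of_notMem ξ a fun h => he (mem_EdgeFinset.1 h)⟩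
  invFun ω := fun e => ω.1 e
  left_inv a := funext fun e => glue_apply_coe ξ a e
  right_inv ω := Subtype.ext (glue_restrict _ fun e he => ω.2 e fun h => he (mem_EdgeFinset.2 h))

open Classical in
/-- The total random-cluster weight of the configurations in `A` agreeing with `ξ` off `E_Λ`. -/
noncomputable def rcMass (S : Ray m → Ray m → Prop) (p q : ℝ) (Λ : Finset (V m))
    (ξ : Config m) (A : Set (Config m)) : ℝ :=
  ∑ a : {e // e ∈ EdgeFinset Λ} → Bool with glue (EdgeFinset Λ) ξ a ∈ A,
    rcWeightReal S p q Λ (glue (EdgeFinset Λ) ξ a)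

lemma rcMass_univ (S : Ray m → Ray m → Prop) (p q : ℝ) (Λ : Finset (V m)) (ξ : Config m) :
    rcMass S p q Λ ξ Set.univ =
      ∑ a : {e // e ∈ EdgeFinset Λ} → Bool, rcWeightReal S p q Λ (glue (EdgeFinset Λ) ξ a) := by
  simp [rcMass]

lemma rcMass_univ_pos (hp0 : 0 ≤ p) (hp1 : p ≤ 1) (hq : 1 ≤ q) (Λ : Finset (V m))
    (ξ : Config m) : 0 < rcMass S p q Λ ξ Set.univ := by
  have hq0 : 0 < q := by linarith
  rw [rcMass_univ]
  refine Finset.sum_pos' (fun _ _ => rcWeightReal_nonneg hp0 hp1 hq _ _) ?_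
  rcases hp0.eq_or_lt with rfl | hp
  · refine ⟨fun _ => false, Finset.mem_univ _, mul_pos (Finset.prod_pos fun e he => ?_)
      (pow_pos hq0 _)⟩
    simp [glue, he]
  · refine ⟨fun _ => true, Finset.mem_univ _, mul_pos (Finset.prod_pos fun e he => ?_)
      (pow_pos hq0 _)⟩
    simp [glue, he, hp]

lemma rcUnnorm_apply (hp0 : 0 ≤ p) (hp1 : p ≤ 1) (hq : 1 ≤ q) (Λ : Finset (V m))
    (ξ : Config m) {A : Set (Config m)} (hA : MeasurableSet A) :
    rcUnnorm S p q Λ ξ A = ENNReal.ofReal (rcMass S p q Λ ξ A) := by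
  classical
  rw [rcUnnorm, Measure.sum_apply _ hA, ← (cylinderEquiv Λ ξ).tsum_eq, tsum_fintype, rcMass,
    ENNReal.ofReal_sum_of_nonneg fun _ _ => rcWeightReal_nonneg hp0 hp1 hq _ _,
    Finset.sum_filter]
  refine Finset.sum_congr rfl fun a _ => ?_
  simp only [cylinderEquiv, Equiv.coe_fn_mk, Measure.smul_apply, smul_eq_mul,
    Measure.dirac_apply' _ hA, rcWeight_eq_ofReal hp0 hp1 hq, Set.indicator_apply, Pi.one_apply]
  split_ifs <;> simp

lemma rcFin_apply (hp0 : 0 ≤ p) (hp1 : p ≤ 1) (hq : 1 ≤ q) (Λ : Finset (V m))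
    (ξ : Config m) {A : Set (Config m)} (hA : MeasurableSet A) :
    rcFin S p q Λ ξ A =
      ENNReal.ofReal (rcMass S p q Λ ξ A / rcMass S p q Λ ξ Set.univ) := by
  rw [rcFin, Measure.smul_apply, smul_eq_mul, rcUnnorm_apply hp0 hp1 hq Λ ξ hA,
    rcUnnorm_apply hp0 hp1 hq Λ ξ MeasurableSet.univ,
    ENNReal.ofReal_div_of_pos (rcMass_univ_pos hp0 hp1 hq Λ ξ), ENNReal.div_eq_inv_mul]

lemma isProbabilityMeasure_rcFin (hp0 : 0 ≤ p) (hp1 : p ≤ 1) (hq : 1 ≤ q) (Λ : Finset (V m))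
    (ξ : Config m) : IsProbabilityMeasure (rcFin S p q Λ ξ) :=
  ⟨by rw [rcFin_apply hp0 hp1 hq Λ ξ MeasurableSet.univ,
    div_self (rcMass_univ_pos hp0 hp1 hq Λ ξ).ne', ENNReal.ofReal_one]⟩

/-- Holley's inequality for unnormalised weights. -/
lemma sum_mul_sum_le_of_holley {D : Type*} [DistribLattice D] [Fintype D] {f g : D → ℝ}
    (hf : 0 ≤ f) (hg : 0 ≤ g) (h : ∀ a b, f a * g b ≤ f (a ⊓ b) * g (a ⊔ b))
    (s t : Finset D) (hst : ∀ a ∈ s, ∀ b, a ≤ b → b ∈ t) :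
    (∑ a ∈ s, f a) * ∑ a, g a ≤ (∑ a ∈ t, g a) * ∑ a, f a := by
  classical
  refine (four_functions_theorem f g f g hf hg hf hg h s Finset.univ).trans ?_
  rw [mul_comm]
  refine mul_le_mul (Finset.sum_le_sum_of_subset_of_nonneg ?_ fun i _ _ => hg i)
    (Finset.sum_le_sum_of_subset_of_nonneg (Finset.subset_univ _) fun i _ _ => hf i)
    (Finset.sum_nonneg fun i _ => hf i) (Finset.sum_nonneg fun i _ => hg i)
  intro x hx
  obtain ⟨a, ha, b, _, rfl⟩ := Finset.mem_sups.1 hx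
  exact hst a ha _ le_sup_left

lemma glue_mem_of_le {E : Finset (Edge m)} {A : Set (Config m)} (hA : IncreasingEvent A)
    {ξ ξ' : Config m} (hξ : ∀ e, ξ e = true → ξ' e = true) {a b : {e // e ∈ E} → Bool}
    (hab : a ≤ b) (ha : glue E ξ a ∈ A) : glue E ξ' b ∈ A :=
  hA _ _ (glue_mono hξ hab) ha

lemma rcWeightReal_mul_le (hST : ∀ x y, S x y → T x y) (hp0 : 0 ≤ p) (hp1 : p ≤ 1)
    (hq : 1 ≤ q) (Λ : Finset (V m)) {ω ω' : Config m}
    (h : ∀ e, e ∉ ELam (↑Λ : Set (V m)) → ω e = true → ω' e = true) :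
    rcWeightReal S p q Λ ω * rcWeightReal T p q Λ ω' ≤
      rcWeightReal S p q Λ (ω ⊓ ω') * rcWeightReal T p q Λ (ω ⊔ ω') := by
  simp only [rcWeightReal]
  rw [mul_mul_mul_comm, mul_mul_mul_comm (edgeWeight p (1 - p) (EdgeFinset Λ) (ω ⊓ ω')),
    ← edgeWeight_mul, ← pow_add, ← pow_add]
  exact mul_le_mul_of_nonneg_left (pow_le_pow_right₀ hq (kCount_add_le hST Λ h))
    (mul_nonneg (edgeWeight_nonneg hp0 (by linarith) _ _)
      (edgeWeight_nonneg hp0 (by linarith) _ _))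

lemma glue_inf_glue {E : Finset (Edge m)} {ξ ξ' : Config m}
    (hξ : ∀ e, ξ e = true → ξ' e = true) (a b : {e // e ∈ E} → Bool) :
    glue E ξ a ⊓ glue E ξ' b = glue E ξ (a ⊓ b) := by
  funext e
  have := hξ e
  by_cases he : e ∈ E
  · simp [glue, he]
  · cases h : ξ e <;> simp_all [glue]

lemma glue_sup_glue {E : Finset (Edge m)} {ξ ξ' : Config m}
    (hξ : ∀ e, ξ e = true → ξ' e = true) (a b : {e // e ∈ E} → Bool) :
    glue E ξ a ⊔ glue E ξ' b = glue E ξ' (a ⊔ b) := by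
  funext e
  have := hξ e
  by_cases he : e ∈ E
  · simp [glue, he]
  · cases h : ξ e <;> simp_all [glue]

lemma rcFin_stochLE (hST : ∀ x y, S x y → T x y) (hp0 : 0 ≤ p) (hp1 : p ≤ 1) (hq : 1 ≤ q)
    (Λ : Finset (V m)) {ξ ξ' : Config m} (hξ : ∀ e, ξ e = true → ξ' e = true) :
    StochLE (rcFin S p q Λ ξ) (rcFin T p q Λ ξ') := by
  classical
  intro A hA hinc
  rw [rcFin_apply hp0 hp1 hq Λ ξ hA, rcFin_apply hp0 hp1 hq Λ ξ' hA]
  refine ENNReal.ofReal_le_ofReal ?_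
  rw [div_le_div_iff₀ (rcMass_univ_pos hp0 hp1 hq Λ ξ) (rcMass_univ_pos hp0 hp1 hq Λ ξ'),
    rcMass_univ, rcMass_univ]
  refine sum_mul_sum_le_of_holley (fun a => rcWeightReal_nonneg hp0 hp1 hq _ _)
    (fun a => rcWeightReal_nonneg hp0 hp1 hq _ _) (fun a b => ?_) _ _ fun a ha b hab => ?_
  · rw [← glue_inf_glue hξ, ← glue_sup_glue hξ]
    refine rcWeightReal_mul_le hST hp0 hp1 hq Λ fun e he => ?_
    rw [← mem_EdgeFinset] at he
    rw [glue_of_notMem _ _ he, glue_of_notMem _ _ he]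
    exact hξ e
  · simp only [Finset.mem_filter, Finset.mem_univ, true_and] at ha ⊢
    exact glue_mem_of_le hinc hξ hab ha

lemma edgeWeight_eq_mul_pow (x y q : ℝ) (E : Finset (Edge m)) (ω : Config m) :
    edgeWeight x (q * y) E ω =
      edgeWeight x y E ω * q ^ (E.filter fun e => ω e = false).card := by
  rw [edgeWeight, edgeWeight, Finset.card_filter, ← Finset.prod_pow_eq_pow_sum,
    ← Finset.prod_mul_distrib]
  refine Finset.prod_congr rfl fun e _ => ?_
  cases ω e <;> simp [mul_comm]

lemma edgeWeight_mul_rcWeightReal_le (hp0 : 0 ≤ p) (hp1 : p ≤ 1) (hq : 1 ≤ q)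
    (Λ : Finset (V m)) {ω ω' : Config m}
    (h : ∀ e, e ∉ ELam (↑Λ : Set (V m)) → ω e = true → ω' e = true) :
    edgeWeight p (q * (1 - p)) (EdgeFinset Λ) ω * rcWeightReal S p q Λ ω' ≤
      edgeWeight p (q * (1 - p)) (EdgeFinset Λ) (ω ⊓ ω') * rcWeightReal S p q Λ (ω ⊔ ω') := by
  simp only [rcWeightReal, edgeWeight_eq_mul_pow]
  rw [mul_mul_mul_comm, mul_mul_mul_comm (edgeWeight p (1 - p) (EdgeFinset Λ) (ω ⊓ ω')),
    ← edgeWeight_mul, ← pow_add, ← pow_add]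
  refine mul_le_mul_of_nonneg_left (pow_le_pow_right₀ hq ?_)
    (mul_nonneg (edgeWeight_nonneg hp0 (by linarith) _ _)
      (edgeWeight_nonneg hp0 (by linarith) _ _))
  have hk := kCount_le_add_card S Λ h
  have hcard : ((EdgeFinset Λ).filter fun e => (ω ⊓ ω') e = false).card =
      ((EdgeFinset Λ).filter fun e => ω e = false).card +
        ((EdgeFinset Λ).filter fun e => ω e = true ∧ ω' e = false).card := by
    simp only [Finset.card_filter, ← Finset.sum_add_distrib]
    refine Finset.sum_congr rfl fun e _ => ?_
    simp only [Pi.inf_apply]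
    rcases Bool.eq_false_or_eq_true (ω e) with h | h <;>
      rcases Bool.eq_false_or_eq_true (ω' e) with h' | h' <;> simp [h, h']
  omega

end FiniteVolume

/-! ### Cylinder events -/

/-- The event `A` depends only on the states of the edges in `E`. -/
def DependsOnEdges (E : Finset (Edge m)) (A : Set (Config m)) : Prop :=
  ∀ ω ω' : Config m, (∀ e ∈ E, ω e = ω' e) → ω ∈ A → ω' ∈ A

lemma DependsOnEdges.isClopen {E : Finset (Edge m)} {A : Set (Config m)}
    (h : DependsOnEdges E A) : IsClopen A := by
  have hA : A = E.restrict ⁻¹' (E.restrict '' A : Set ((e : E) → Bool)) := by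
    refine Set.Subset.antisymm (Set.subset_preimage_image _ _) ?_
    rintro ω ⟨ω', hω', hEq⟩
    exact h ω' ω (fun e he => congrFun hEq ⟨e, he⟩) hω'
  rw [hA]
  exact (isClopen_discrete _).preimage (continuous_pi fun e => continuous_apply _)

lemma DependsOnEdges.measurableSet {E : Finset (Edge m)} {A : Set (Config m)}
    (h : DependsOnEdges E A) : MeasurableSet A :=
  h.isClopen.isClosed.measurableSet

lemma DependsOnEdges.mono {E F : Finset (Edge m)} (hEF : E ⊆ F) {A : Set (Config m)}
    (h : DependsOnEdges E A) : DependsOnEdges F A :=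
  fun ω ω' hω => h ω ω' fun e he => hω e (hEF he)

/-- The event that some member of `K` is dominated on `E`. -/
def upperOn (K : Set (Config m)) (E : Finset (Edge m)) : Set (Config m) :=
  {ω | ∃ κ ∈ K, ∀ e ∈ E, κ e = true → ω e = true}

lemma iInter_upperOn_subset {K : Set (Config m)} (hK : IsClosed K) {A : Set (Config m)}
    (hKA : K ⊆ A) (hA : IncreasingEvent A) : ⋂ E, upperOn K E ⊆ A := by
  classical
  intro ω hω
  let C : Finset (Edge m) → Set (Config m) :=
    fun E => K ∩ {κ | ∀ e ∈ E, κ e = true → ω e = true}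
  have hC : ∀ E, IsClosed (C E) := by
    refine fun E => hK.inter (DependsOnEdges.isClopen (E := E) ?_).isClosed
    intro κ κ' h hκ e he h'
    exact hκ e he ((h e he).trans h')
  obtain ⟨κ, hκ⟩ := IsCompact.nonempty_iInter_of_directed_nonempty_isCompact_isClosed C
    (fun E F => ⟨E ∪ F,
      fun κ h => ⟨h.1, fun e he => h.2 e (Finset.mem_union_left _ he)⟩,
      fun κ h => ⟨h.1, fun e he => h.2 e (Finset.mem_union_right _ he)⟩⟩)
    (fun E => by
      obtain ⟨κ, hκ, h⟩ := Set.mem_iInter.1 hω E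
      exact ⟨κ, hκ, h⟩)
    (fun E => (hC E).isCompact) hC
  rw [Set.mem_iInter] at hκ
  exact hA κ ω (fun e he => (hκ {e}).2 e (Finset.mem_singleton_self e) he) (hKA (hκ ∅).1)

/-- Stochastic ordering need only be checked on increasing cylinder events. -/
lemma stochLE_of_cylinder {μ ν : Measure (Config m)} [IsFiniteMeasure μ] [IsFiniteMeasure ν]
    (h : ∀ (E : Finset (Edge m)) (A : Set (Config m)), DependsOnEdges E A →
      IncreasingEvent A → μ A ≤ ν A) : StochLE μ ν := by
  classical
  intro A hA hinc
  refine le_of_forall_lt fun r hr => ?_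
  obtain ⟨K, hKA, hK, hrK⟩ := hA.exists_lt_isClosed_of_ne_top (measure_ne_top μ A) hr
  refine hrK.trans_le ?_
  have hdep : ∀ E, DependsOnEdges E (upperOn K E) := by
    rintro E ω ω' hω ⟨κ, hκ, hle⟩
    exact ⟨κ, hκ, fun e he h => (hω e he).symm.trans (hle e he h)⟩
  have hdir : Directed (· ⊇ ·) (upperOn K) := fun E F => ⟨E ∪ F,
    fun ω ⟨κ, hκ, h⟩ => ⟨κ, hκ, fun e he => h e (Finset.mem_union_left _ he)⟩,
    fun ω ⟨κ, hκ, h⟩ => ⟨κ, hκ, fun e he => h e (Finset.mem_union_right _ he)⟩⟩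
  have hsub : ∀ E, K ⊆ upperOn K E := fun E κ hκ => ⟨κ, hκ, fun _ _ h => h⟩
  calc μ K ≤ ⨅ E, ν (upperOn K E) := le_iInf fun E =>
        (measure_mono (hsub E)).trans (h E _ (hdep E)
          fun ω ω' hω ⟨κ, hκ, hle⟩ => ⟨κ, hκ, fun e he h => hω e (hle e he h)⟩)
    _ = ν (⋂ E, upperOn K E) := (hdir.measure_iInter
        (fun E => (hdep E).measurableSet.nullMeasurableSet) ⟨∅, measure_ne_top _ _⟩).symm
    _ ≤ ν A := measure_mono (iInter_upperOn_subset hK hKA hinc)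

lemma WeakLim.tendsto_measure {μs : Finset (V m) → Measure (Config m)}
    (hμs : ∀ Λ, IsProbabilityMeasure (μs Λ)) {φ : Measure (Config m)} [IsFiniteMeasure φ]
    (h : WeakLim μs φ) {A : Set (Config m)} (hA : IsClopen A) :
    Tendsto (fun Λ => μs Λ A) atTop (nhds (φ A)) := by
  have := h (BoundedContinuousFunction.indicator A hA)
  simp only [BoundedContinuousFunction.indicator_apply,
    integral_indicator_one hA.isClosed.measurableSet] at this
  rw [← ENNReal.tendsto_toReal_iff (fun Λ => measure_ne_top _ _) (measure_ne_top _ _)]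
  exact this

/-- Every finite edge set is contained in `E_Λ` for some finite `Λ`. -/
lemma exists_subset_EdgeFinset (E : Finset (Edge m)) :
    ∃ Λ : Finset (V m), E ⊆ EdgeFinset Λ := by
  classical
  refine ⟨E.image parentV ∪ E.image childV, fun e he => ?_⟩
  rw [mem_EdgeFinset]
  exact ⟨Finset.mem_coe.2 (Finset.mem_union_left _ (Finset.mem_image_of_mem _ he)),
    Finset.mem_coe.2 (Finset.mem_union_right _ (Finset.mem_image_of_mem _ he))⟩

open Classical in
lemma IsBernoulliProduct.measure_eq_sum {r : ℝ} (hr0 : 0 ≤ r) (hr1 : r ≤ 1)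
    {μ : Measure (Config m)} (hμ : IsBernoulliProduct r μ) {E : Finset (Edge m)}
    {A : Set (Config m)} (hA : DependsOnEdges E A) (ξ : Config m) :
    μ A = ENNReal.ofReal (∑ a : {e // e ∈ E} → Bool with glue E ξ a ∈ A,
      edgeWeight r (1 - r) E (glue E ξ a)) := by
  have hunion : A = ⋃ a ∈ Finset.univ.filter fun a : {e // e ∈ E} → Bool => glue E ξ a ∈ A,
      {ω | ∀ e ∈ E, ω e = glue E ξ a e} := by
    ext ω
    simp only [Finset.mem_filter, Finset.mem_univ, true_and, Set.mem_iUnion, Set.mem_ofPred_eq,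
      exists_prop]
    constructor
    · intro hω
      have hres : ∀ e ∈ E, ω e = glue E ξ (fun e => ω e) e := fun e he => by simp [glue, he]
      exact ⟨fun e => ω e, hA _ _ hres hω, hres⟩
    · rintro ⟨a, ha, hω⟩
      exact hA _ _ (fun e he => (hω e he).symm) ha
  conv_lhs => rw [hunion]
  rw [measure_biUnion_finset, ENNReal.ofReal_sum_of_nonneg
    fun _ _ => edgeWeight_nonneg hr0 (by linarith) _ _]
  · refine Finset.sum_congr rfl fun a _ => ?_
    rw [hμ.2, edgeWeight, ENNReal.ofReal_prod_of_nonneg]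
    intro e _
    split_ifs <;> linarith
  · intro a _ b _ hab
    refine Set.disjoint_left.2 fun ω ha hb => hab (funext fun e => ?_)
    rw [← glue_apply_coe ξ a e, ← glue_apply_coe ξ b e, ← ha e e.2, hb e e.2]
  · intro a _
    refine (DependsOnEdges.measurableSet (E := E) ?_)
    exact fun ω ω' h hω e he => (h e he).symm.trans (hω e he)

lemma edgeWeight_div (x y c : ℝ) (E : Finset (Edge m)) (ω : Config m) :
    edgeWeight (x / c) (y / c) E ω = edgeWeight x y E ω / c ^ E.card := by
  rw [edgeWeight, edgeWeight, ← Finset.prod_const, ← Finset.prod_div_distrib]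
  exact Finset.prod_congr rfl fun e _ => by split_ifs <;> rfl

/-- A product measure of density `p / (p + q (1 - p))` is dominated by every finite-volume
random-cluster measure, on increasing events depending only on `E_Λ`. -/
lemma bernoulli_le_rcFin {S : Ray m → Ray m → Prop} {p q : ℝ} (hp0 : 0 ≤ p) (hp1 : p ≤ 1)
    (hq : 1 ≤ q) {μ : Measure (Config m)}
    (hμ : IsBernoulliProduct (p / (p + q * (1 - p))) μ) {Λ : Finset (V m)}
    {A : Set (Config m)} (hA : DependsOnEdges (EdgeFinset Λ) A) (hinc : IncreasingEvent A)
    (ξ : Config m) : μ A ≤ rcFin S p q Λ ξ A := by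
  classical
  have := hμ.1
  have hq1 : 0 ≤ q * (1 - p) := mul_nonneg (by linarith) (by linarith)
  have hc : 0 < p + q * (1 - p) := by nlinarith
  have hr0 : 0 ≤ p / (p + q * (1 - p)) := div_nonneg hp0 hc.le
  have hr1 : p / (p + q * (1 - p)) ≤ 1 := (div_le_one hc).2 (by linarith)
  have hone : 1 - p / (p + q * (1 - p)) = q * (1 - p) / (p + q * (1 - p)) := by
    field_simp
    ring
  have hsum := fun {B : Set (Config m)} (hB : DependsOnEdges (EdgeFinset Λ) B) =>
    hμ.measure_eq_sum hr0 hr1 hB ξ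
  simp only [hone, edgeWeight_div, ← Finset.sum_div] at hsum
  have htot : ∑ a : {e // e ∈ EdgeFinset Λ} → Bool, edgeWeight p (q * (1 - p)) (EdgeFinset Λ)
      (glue (EdgeFinset Λ) ξ a) = (p + q * (1 - p)) ^ (EdgeFinset Λ).card := by
    have h1 := hsum (B := Set.univ) fun _ _ _ _ => Set.mem_univ _
    rw [measure_univ, eq_comm, ENNReal.ofReal_eq_one] at h1
    simpa [div_eq_one_iff_eq (pow_pos hc _).ne'] using h1
  rw [hsum hA, rcFin_apply hp0 hp1 hq Λ ξ hA.measurableSet]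
  refine ENNReal.ofReal_le_ofReal ?_
  rw [div_le_div_iff₀ (pow_pos hc _) (rcMass_univ_pos hp0 hp1 hq Λ ξ), ← htot, rcMass_univ]
  refine sum_mul_sum_le_of_holley (fun a => edgeWeight_nonneg hp0 hq1 _ _)
    (fun a => rcWeightReal_nonneg hp0 hp1 hq _ _) (fun a b => ?_) _ _ fun a ha b hab => ?_
  · rw [← glue_inf_glue fun _ h => h, ← glue_sup_glue fun _ h => h]
    refine edgeWeight_mul_rcWeightReal_le hp0 hp1 hq Λ fun e he => ?_
    rw [← mem_EdgeFinset] at he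
    rw [glue_of_notMem _ _ he, glue_of_notMem _ _ he]
    exact id
  · simp only [Finset.mem_filter, Finset.mem_univ, true_and] at ha ⊢
    exact glue_mem_of_le hinc (fun _ h => h) hab ha

/-- The defining equation of a random-cluster measure, on the whole space. -/
lemma measure_eq_lintegral_rcFin {S : Ray m → Ray m → Prop} {p q : ℝ}
    {φ : Measure (Config m)} (hφ : φ ∈ RCSet S p q) (Λ : Finset (V m)) {A : Set (Config m)}
    (hA : MeasurableSet A) : φ A = ∫⁻ ξ, rcFin S p q Λ ξ A ∂φ := by
  simpa using hφ.2 Λ A hA Set.univ (@MeasurableSet.univ _ (outSigma Λ))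

/-- For a closed equivalence relation `∼`, `p ∈ [0,1]`, `q ≥ 1`, and any
`(∼)`random-cluster measure `φ`, one has
`φ_π ≤st φ ≤st φ^{1,∼}_{p,q} ≤st φ¹_{p,q}` in the stochastic ordering. -/
theorem rc_stochastic_sandwich (m : ℕ) (hm : 2 ≤ m) (S : Ray m → Ray m → Prop)
    (hequiv : Equivalence S) (hclosed : IsClosedRel S)
    (p q : ℝ) (hp0 : 0 ≤ p) (hp1 : p ≤ 1) (hq : 1 ≤ q)
    (pi : ℝ) (hpi : pi = p / (p + q * (1 - p)))
    (phipi : Measure (Config m)) (hphipi : IsBernoulliProduct pi phipi)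
    (φ : Measure (Config m)) (hφ : φ ∈ RCSet S p q)
    (ψ : Measure (Config m)) (hψprob : IsProbabilityMeasure ψ)
    (hψ : WeakLim (fun Λ => rcFin S p q Λ (oneCfg m)) ψ)
    (ψw : Measure (Config m)) (hψwprob : IsProbabilityMeasure ψw)
    (hψw : WeakLim (fun Λ => rcFin (wiredRel m) p q Λ (oneCfg m)) ψw) :
    StochLE phipi φ ∧ StochLE φ ψ ∧ StochLE ψ ψw := by
  subst hpi
  have hφprob := hφ.1
  have hphipiprob := hphipi.1
  have hprob : ∀ (T : Ray m → Ray m → Prop) (Λ : Finset (V m)),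
      IsProbabilityMeasure (rcFin T p q Λ (oneCfg m)) :=
    fun T Λ => isProbabilityMeasure_rcFin hp0 hp1 hq Λ _
  refine ⟨stochLE_of_cylinder fun E A hA hinc => ?_, stochLE_of_cylinder fun E A hA hinc => ?_,
    stochLE_of_cylinder fun E A hA hinc => ?_⟩
  · obtain ⟨Λ, hΛ⟩ := exists_subset_EdgeFinset E
    rw [measure_eq_lintegral_rcFin hφ Λ hA.measurableSet]
    calc phipi A = ∫⁻ _, phipi A ∂φ := by simp
      _ ≤ _ := lintegral_mono fun ξ =>
        bernoulli_le_rcFin hp0 hp1 hq hphipi (hA.mono hΛ) hinc ξ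
  · refine ge_of_tendsto' (hψ.tendsto_measure (hprob S) hA.isClopen) fun Λ => ?_
    rw [measure_eq_lintegral_rcFin hφ Λ hA.measurableSet]
    calc _ ≤ ∫⁻ _, rcFin S p q Λ (oneCfg m) A ∂φ := lintegral_mono fun ξ =>
          rcFin_stochLE (fun _ _ h => h) hp0 hp1 hq Λ (fun _ _ => rfl) A hA.measurableSet hinc
      _ = _ := by simp
  · exact le_of_tendsto_of_tendsto' (hψ.tendsto_measure (hprob S) hA.isClopen)
      (hψw.tendsto_measure (hprob (wiredRel m)) hA.isClopen) fun Λ =>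
        rcFin_stochLE (fun _ _ _ => trivial) hp0 hp1 hq Λ (fun _ h => h) A hA.measurableSet hinc

end RCTree
end

section
/- Let ∼ be an arbitrary equivalence relation on the set R of rays of T'_m, let q≥1 and p∈[0,1], and let ol∼ denote the closure of ∼. Then φ^{1,∼}_{Λ,p,q} converges weakly to φ^{1,ol∼}_{p,q} as Λ↑V. -/
namespace RCTree

variable {m : ℕ}

open MeasureTheory Filter
open scoped ENNReal

/-- The distance of a vertex from the root. -/
def vDepth : V m → ℕ
  | none => 0
  | some e => e.2.length + 1

lemma vDepth_rayVtx (ρ : Ray m) (n : ℕ) : vDepth (rayVtx ρ n) = n := by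
  cases n <;> simp [rayVtx, vDepth, rayEdge]

lemma rayVtx_injective (ρ : Ray m) : Function.Injective (rayVtx ρ) := fun a b h => by
  rw [← vDepth_rayVtx ρ a, h, vDepth_rayVtx]

lemma parentV_rayEdge (ρ : Ray m) (n : ℕ) : parentV (rayEdge ρ n) = rayVtx ρ n := by
  cases n with
  | zero => simp [parentV, rayEdge, rayVtx]
  | succ n =>
    have h : List.ofFn (fun k : Fin (n + 1) => ρ.2 k) ≠ [] := by simp
    rw [parentV, if_neg (by exact h)]
    simp only [rayEdge, rayVtx]
    rw [List.ofFn_succ', List.concat_eq_append, List.dropLast_concat]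
    rfl

lemma endsAt_rayEdge (ρ : Ray m) (n : ℕ) :
    EndsAt (rayEdge ρ n) (rayVtx ρ n) (rayVtx ρ (n + 1)) :=
  Or.inl ⟨parentV_rayEdge ρ n, rfl⟩

lemma EndsAt.symm {e : Edge m} {u v : V m} (h : EndsAt e u v) : EndsAt e v u :=
  Or.symm h

lemma vDepth_parentV (e : Edge m) : vDepth (parentV e) + 1 = vDepth (childV e) := by
  rcases e with ⟨i, l⟩
  by_cases h : l = []
  · simp [parentV, childV, vDepth, h]
  · have := List.length_pos_iff.2 h
    simp only [parentV, childV, vDepth, h, if_false, List.length_dropLast]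
    omega

lemma eq_rayEdge_of_endsAt {ρ : Ray m} {n : ℕ} {e : Edge m}
    (h : EndsAt e (rayVtx ρ n) (rayVtx ρ (n + 1))) : e = rayEdge ρ n := by
  rcases h with ⟨-, h⟩ | ⟨h₁, h₂⟩
  · exact Option.some_injective _ h
  · have := vDepth_parentV e
    rw [h₁, h₂, vDepth_rayVtx, vDepth_rayVtx] at this
    omega

lemma finite_endsAt (u v : V m) : {e : Edge m | EndsAt e u v}.Finite := by
  refine Set.Finite.subset (((Set.finite_singleton v).insert u).preimage
    (f := (childV : Edge m → V m)) (Option.some_injective _).injOn) ?_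
  rintro e (⟨-, h⟩ | ⟨-, h⟩) <;> simp [h]

lemma EndsAt.notMem_eLam {Λ : Set (V m)} {e f : Edge m} {u v : V m}
    (he : EndsAt e u v) (hf : EndsAt f u v) (h : e ∉ ELam Λ) : f ∉ ELam Λ := by
  simp only [ELam, Set.mem_ofPred_eq] at h ⊢
  rcases he with ⟨h₁, h₂⟩ | ⟨h₁, h₂⟩ <;> rcases hf with ⟨h₃, h₄⟩ | ⟨h₃, h₄⟩ <;>
    rw [h₁, h₂] at h <;> rw [h₃, h₄] <;> tauto

/-- `u` and `v` are the endvertices of an edge outside `E_Λ`. -/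
def OutAdj (Λ : Set (V m)) (u v : V m) : Prop := ∃ e : Edge m, e ∉ ELam Λ ∧ EndsAt e u v

/-- `u` and `v` are joined by a path of edges outside `E_Λ`. -/
def OutReach (Λ : Set (V m)) : V m → V m → Prop := Relation.ReflTransGen (OutAdj Λ)

lemma OutReach.symm {Λ : Set (V m)} {u v : V m} (h : OutReach Λ u v) : OutReach Λ v u := by
  induction h with
  | refl => exact Relation.ReflTransGen.refl
  | tail _ h ih =>
    obtain ⟨e, he, h⟩ := h
    exact ih.head ⟨e, he, h.symm⟩

lemma OutReach.trans {Λ : Set (V m)} {u v w : V m} (h : OutReach Λ u v)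
    (h' : OutReach Λ v w) : OutReach Λ u w :=
  Relation.ReflTransGen.trans h h'

lemma OutReach.outConn {Λ : Set (V m)} {ω : Config m} (hω : ∀ e, e ∉ ELam Λ → ω e = true)
    {u v : V m} (h : OutReach Λ u v) : OutConn Λ ω u v := by
  induction h with
  | refl => exact ⟨0, fun _ => u, rfl, rfl, by simp⟩
  | @tail b c _ hbc ih =>
    obtain ⟨n, f, h0, hn, hf⟩ := ih
    obtain ⟨e, he, hbc⟩ := hbc
    refine ⟨n + 1, fun i => if i ≤ n then f i else c, by simpa using h0, by simp, ?_⟩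
    intro i hi
    rcases Nat.lt_succ_iff_lt_or_eq.1 hi with hi | rfl
    · simpa [hi.le, Nat.succ_le_of_lt hi] using hf i hi
    · exact ⟨e, hω e he, he, by simpa [hn] using hbc⟩

lemma OutReach.of_vtx {Λ : Set (V m)} {x : V m} {π : IPath m x}
    (h : ∀ e ∈ π.edges, e ∉ ELam Λ) (n : ℕ) : OutReach Λ x (π.vtx n) := by
  induction n with
  | zero => rw [π.start]; exact Relation.ReflTransGen.refl
  | succ n ih =>
    obtain ⟨e, he⟩ := π.adj n
    exact ih.tail ⟨e, h e ⟨n, he⟩, he⟩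

lemma rayEdge_notMem_eLam (Λ : Finset (V m)) (ρ : Ray m) {n : ℕ} (hn : Λ.sup vDepth ≤ n) :
    rayEdge ρ n ∉ ELam (Λ : Set (V m)) := by
  rintro ⟨-, h⟩
  have h₁ : vDepth (childV (rayEdge ρ n)) ≤ Λ.sup vDepth := Finset.le_sup h
  have h₂ : vDepth (childV (rayEdge ρ n)) = n + 1 := vDepth_rayVtx ρ (n + 1)
  omega

lemma outReach_rayVtx (Λ : Finset (V m)) (ρ : Ray m) {n : ℕ} (hn : Λ.sup vDepth ≤ n) :
    OutReach (Λ : Set (V m)) (rayVtx ρ (Λ.sup vDepth)) (rayVtx ρ n) := by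
  induction n, hn using Nat.le_induction with
  | base => exact Relation.ReflTransGen.refl
  | succ n hn ih =>
    exact ih.tail ⟨rayEdge ρ n, rayEdge_notMem_eLam Λ ρ hn, endsAt_rayEdge ρ n⟩

/-- Every vertex is joined outside `E_Λ` to a vertex of `Λ`, if `Λ` is nonempty. -/
lemma exists_outReach {Λ : Set (V m)} (hΛ : Λ.Nonempty) (x : V m) :
    ∃ u ∈ Λ, OutReach Λ u x := by
  have step : ∀ (e : Edge m) (x y : V m), EndsAt e x y →
      (∃ u ∈ Λ, OutReach Λ u x) → ∃ u ∈ Λ, OutReach Λ u y := by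
    rintro e x y h ⟨u, hu, hux⟩
    by_cases he : e ∈ ELam Λ
    · refine ⟨y, ?_, Relation.ReflTransGen.refl⟩
      rcases h with ⟨-, h⟩ | ⟨h, -⟩
      · exact h ▸ he.2
      · exact h ▸ he.1
    · exact ⟨u, hu, hux.tail ⟨e, he, h⟩⟩
  have root : ∀ (n : ℕ) (x : V m), vDepth x = n →
      ((∃ u ∈ Λ, OutReach Λ u x) ↔ ∃ u ∈ Λ, OutReach Λ u none) := by
    intro n
    induction n with
    | zero => intro x hx; cases x <;> simp_all [vDepth]
    | succ n ih =>
      intro x hx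
      cases x with
      | none => rfl
      | some e =>
        have h : EndsAt e (parentV e) (some e) := Or.inl ⟨rfl, rfl⟩
        have hd := vDepth_parentV e
        rw [← ih (parentV e) (by simp only [childV] at hd; omega)]
        exact ⟨step e _ _ h.symm, step e _ _ h⟩
  obtain ⟨v, hv⟩ := hΛ
  exact (root _ x rfl).2 ((root _ v rfl).1 ⟨v, hv, Relation.ReflTransGen.refl⟩)

/-- The `0`-ray associated with a path edge-disjoint from `E_Λ` is joined outside `E_Λ` to the
endpoint of the path. -/
lemma Assoc.outReach {Λ : Finset (V m)} {x : V m} {π : IPath m x} {ρ : Ray m} (h : Assoc π ρ)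
    (hπ : ∀ e ∈ π.edges, e ∉ ELam (Λ : Set (V m))) :
    OutReach (Λ : Set (V m)) x (rayVtx ρ (Λ.sup vDepth)) := by
  have hinj : Function.Injective (rayEdge ρ) := fun a b hab => by
    simpa using rayVtx_injective ρ (a₁ := a + 1) (a₂ := b + 1) (congrArg some hab)
  have hfin : (rayEdge ρ ⁻¹' (rayEdges ρ \ π.edges)).Finite :=
    (h.subset Set.subset_union_right).preimage hinj.injOn
  obtain ⟨n, hn, hmem⟩ : ∃ n, Λ.sup vDepth ≤ n ∧ rayEdge ρ n ∈ π.edges := by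
    obtain ⟨n, hn⟩ := (hfin.union (Set.finite_lt_nat (Λ.sup vDepth))).exists_notMem
    refine ⟨n, ?_, ?_⟩ <;> by_contra hc
    · exact hn (Or.inr (not_le.1 hc))
    · exact hn (Or.inl ⟨⟨n, rfl⟩, hc⟩)
  obtain ⟨j, hj⟩ : ∃ j, π.vtx j = rayVtx ρ (n + 1) := by
    obtain ⟨k, ⟨-, hk⟩ | ⟨-, hk⟩⟩ := hmem
    exacts [⟨k + 1, hk.symm⟩, ⟨k, hk.symm⟩]
  exact (hj ▸ OutReach.of_vtx hπ j).trans (outReach_rayVtx Λ ρ (by omega)).symm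

lemma assoc_of_eventually_eq {x : V m} {π : IPath m x} {ρ : Ray m} {a b : ℕ}
    (h : ∀ n, π.vtx (a + n) = rayVtx ρ (b + n)) : Assoc π ρ := by
  refine Set.Finite.union
    (((Set.finite_lt_nat a).biUnion fun n _ => finite_endsAt (π.vtx n) (π.vtx (n + 1))).subset ?_)
    (((Set.finite_lt_nat b).image (rayEdge ρ)).subset ?_)
  · rintro e ⟨⟨n, hn⟩, he⟩
    refine Set.mem_biUnion (x := n) ?_ hn
    by_contra hna
    obtain ⟨k, rfl⟩ := Nat.exists_eq_add_of_le (not_lt.1 hna)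
    rw [h k, add_assoc, h (k + 1)] at hn
    exact he ⟨b + k, (eq_rayEdge_of_endsAt hn).symm⟩
  · rintro _ ⟨⟨n, rfl⟩, he⟩
    refine ⟨n, ?_, rfl⟩
    by_contra hnb
    obtain ⟨k, rfl⟩ := Nat.exists_eq_add_of_le (not_lt.1 hnb)
    refine he ⟨a + k, ?_⟩
    rw [h k, add_assoc, h (k + 1)]
    exact endsAt_rayEdge ρ (b + k)

/-- A vertex joined to a ray outside `E_Λ` starts an infinite path, edge-disjoint from `E_Λ`,
whose associated `0`-ray is the given ray. -/
lemma OutReach.exists_assoc {Λ : Finset (V m)} {x : V m} {ρ : Ray m}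
    (h : OutReach (Λ : Set (V m)) x (rayVtx ρ (Λ.sup vDepth))) :
    ∃ π : IPath m x, (∀ e ∈ π.edges, e ∉ ELam (Λ : Set (V m))) ∧ Assoc π ρ := by
  suffices H : ∃ π : IPath m x, (∀ e ∈ π.edges, e ∉ ELam (Λ : Set (V m))) ∧
      ∃ a b, ∀ n, π.vtx (a + n) = rayVtx ρ (b + n) by
    obtain ⟨π, hπ, a, b, hab⟩ := H
    exact ⟨π, hπ, assoc_of_eventually_eq hab⟩
  induction h using Relation.ReflTransGen.head_induction_on with
  | refl =>
    refine ⟨⟨fun n => rayVtx ρ (Λ.sup vDepth + n), rfl,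
      fun i j hij => by simpa using rayVtx_injective ρ hij,
      fun n => ⟨_, endsAt_rayEdge ρ _⟩⟩, ?_, 0, Λ.sup vDepth, fun n => by simp⟩
    rintro e ⟨n, hn⟩
    rw [eq_rayEdge_of_endsAt hn]
    exact rayEdge_notMem_eLam Λ ρ (Nat.le_add_right _ _)
  | @head x y hxy _ ih =>
    obtain ⟨π, hπ, a, b, hab⟩ := ih
    obtain ⟨e, he, hxy⟩ := hxy
    by_cases hx : ∃ j, π.vtx j = x
    · obtain ⟨j, hj⟩ := hx
      refine ⟨⟨fun n => π.vtx (j + n), hj, fun i k hik => by simpa using π.inj hik,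
        fun n => π.adj (j + n)⟩, ?_, a, b + j, fun n => ?_⟩
      · rintro f ⟨n, hn⟩
        exact hπ f ⟨j + n, hn⟩
      · change π.vtx (j + (a + n)) = _
        rw [show j + (a + n) = a + (j + n) by omega, hab, add_assoc]
    · have hadj : EndsAt e x (π.vtx 0) := by rwa [π.start]
      refine ⟨⟨fun n => Nat.casesOn n x π.vtx, rfl, ?_, ?_⟩, ?_, a + 1, b, fun n => ?_⟩
      · rintro (_ | i) (_ | k) hik
        · rfl
        · exact absurd ⟨k, hik.symm⟩ hx
        · exact absurd ⟨i, hik⟩ hx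
        · exact congrArg _ (π.inj hik)
      · rintro (_ | n)
        · exact ⟨e, hadj⟩
        · exact π.adj n
      · rintro f ⟨_ | n, hn⟩
        · exact hadj.notMem_eLam hn he
        · exact hπ f ⟨n, hn⟩
      · rw [add_right_comm]
        exact hab n

lemma isLocallyConstant_rayVtx (n : ℕ) : IsLocallyConstant fun ρ : Ray m => rayVtx ρ n := by
  cases n with
  | zero => exact IsLocallyConstant.const _
  | succ n =>
    have hc : Continuous fun ρ : Ray m => (ρ.1, fun k : Fin n => ρ.2 k) := by fun_prop
    exact ((IsLocallyConstant.iff_continuous _).2 hc).comp fun x => some (x.1, List.ofFn x.2)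

/-- The augmented open graph on `Λ` whose clusters are counted by `kCount`. -/
def augGraph (S : Ray m → Ray m → Prop) (Λ : Finset (V m)) (ω : Config m) :
    SimpleGraph {x // x ∈ Λ} :=
  SimpleGraph.fromRel fun u v => augRel S Λ ω ↑u ↑v

lemma augRel.reachable {S : Ray m → Ray m → Prop} {Λ : Finset (V m)} {ω : Config m}
    {u v : {x // x ∈ Λ}} (h : augRel S Λ ω u v) : (augGraph S Λ ω).Reachable u v := by
  by_cases huv : u = v
  · rw [huv]
  · exact SimpleGraph.Adj.reachable ((SimpleGraph.fromRel_adj _ _ _).2 ⟨huv, Or.inl h⟩)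

lemma reachable_of_rel {S : Ray m → Ray m → Prop} {Λ : Finset (V m)} {ω : Config m}
    (hω : ω ∈ cylinderSet Λ (oneCfg m)) {ρ ρ' : Ray m} (hS : S ρ ρ') {u v : {x // x ∈ Λ}}
    (hu : OutReach (Λ : Set (V m)) u (rayVtx ρ (Λ.sup vDepth)))
    (hv : OutReach (Λ : Set (V m)) v (rayVtx ρ' (Λ.sup vDepth))) :
    (augGraph S Λ ω).Reachable u v := by
  apply augRel.reachable
  by_cases huv : OutReach (Λ : Set (V m)) u v
  · exact Or.inr (Or.inl (huv.outConn hω))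
  · obtain ⟨πu, hπu, hρ⟩ := hu.exists_assoc
    obtain ⟨πv, hπv, hρ'⟩ := hv.exists_assoc
    refine Or.inr (Or.inr ⟨πu, πv, fun a b hab => huv ?_, fun e he => hω e (hπu e he),
      fun e he => hω e (hπv e he), hπu, hπv, ρ, ρ', hρ, hρ', hS⟩)
    exact (OutReach.of_vtx hπu a).trans (hab ▸ (OutReach.of_vtx hπv b).symm)

lemma reachable_of_closureRel {S : Ray m → Ray m → Prop} {Λ : Finset (V m)} {ω : Config m}
    (hω : ω ∈ cylinderSet Λ (oneCfg m)) {ρ ρ' : Ray m} (hS : closureRel S ρ ρ')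
    {u v : {x // x ∈ Λ}}
    (hu : OutReach (Λ : Set (V m)) u (rayVtx ρ (Λ.sup vDepth)))
    (hv : OutReach (Λ : Set (V m)) v (rayVtx ρ' (Λ.sup vDepth))) :
    (augGraph S Λ ω).Reachable u v := by
  let P : V m → V m → Prop := fun x y => ∀ u v : {x // x ∈ Λ},
    OutReach (Λ : Set (V m)) u x → OutReach (Λ : Set (V m)) v y → (augGraph S Λ ω).Reachable u v
  refine hS (fun ρ ρ' => P (rayVtx ρ (Λ.sup vDepth)) (rayVtx ρ' (Λ.sup vDepth)))
    ⟨fun ρ u v hu hv => ?_, fun h u v hu hv => (h v u hv hu).symm, fun h h' u v hu hv => ?_⟩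
    ?_ (fun ρ ρ' h u v hu hv => reachable_of_rel hω h hu hv) u v hu hv
  · exact augRel.reachable (Or.inr (Or.inl ((hu.trans hv.symm).outConn hω)))
  · obtain ⟨w, hw, hwx⟩ := exists_outReach (Λ := (Λ : Set (V m))) ⟨u, u.2⟩ _
    exact (h u ⟨w, hw⟩ hu hwx).trans (h' ⟨w, hw⟩ v hwx hv)
  · have hl := isLocallyConstant_rayVtx (m := m) (Λ.sup vDepth)
    exact ⟨((hl.comp_continuous continuous_fst).prodMk
      (hl.comp_continuous continuous_snd)) {z | P z.1 z.2}ᶜ⟩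

lemma le_closureRel {S : Ray m → Ray m → Prop} {ρ ρ' : Ray m} (h : S ρ ρ') :
    closureRel S ρ ρ' :=
  fun _ _ _ hT => hT _ _ h

lemma reachable_augGraph_closureRel {S : Ray m → Ray m → Prop} {Λ : Finset (V m)}
    {ω : Config m} (hω : ω ∈ cylinderSet Λ (oneCfg m)) (u v : {x // x ∈ Λ}) :
    (augGraph S Λ ω).Reachable u v ↔ (augGraph (closureRel S) Λ ω).Reachable u v := by
  constructor
  · refine fun h => h.mono ?_
    have hle : ∀ u v : {x // x ∈ Λ}, augRel S Λ ω u v → augRel (closureRel S) Λ ω u v := by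
      rintro u v (h | h | ⟨πu, πv, h₁, h₂, h₃, h₄, h₅, ρ, ρ', h₆, h₇, hS⟩)
      · exact Or.inl h
      · exact Or.inr (Or.inl h)
      · exact Or.inr (Or.inr ⟨πu, πv, h₁, h₂, h₃, h₄, h₅, ρ, ρ', h₆, h₇, le_closureRel hS⟩)
    intro u v h
    rw [augGraph, SimpleGraph.fromRel_adj] at h ⊢
    exact ⟨h.1, h.2.imp (hle u v) (hle v u)⟩
  · have hr : ∀ u v : {x // x ∈ Λ}, augRel (closureRel S) Λ ω u v →
        (augGraph S Λ ω).Reachable u v := by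
      rintro u v (h | h | ⟨πu, πv, -, -, -, hu, hv, ρ, ρ', hρ, hρ', hS⟩)
      · exact augRel.reachable (Or.inl h)
      · exact augRel.reachable (Or.inr (Or.inl h))
      · exact reachable_of_closureRel hω hS (hρ.outReach hu) (hρ'.outReach hv)
    rintro ⟨w⟩
    induction w with
    | nil => rfl
    | cons h _ ih =>
      rw [augGraph, SimpleGraph.fromRel_adj] at h
      exact (h.2.elim (hr _ _) fun h => (hr _ _ h).symm).trans ih

lemma kCount_closureRel (S : Ray m → Ray m → Prop) {Λ : Finset (V m)} {ω : Config m}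
    (hω : ω ∈ cylinderSet Λ (oneCfg m)) : kCount S Λ ω = kCount (closureRel S) Λ ω :=
  Nat.card_congr (Quot.congrRight fun u v => reachable_augGraph_closureRel hω u v)

/-- With all-open boundary condition, a relation and its closure have the same finite-volume
random-cluster measures. -/
lemma rcFin_closureRel (S : Ray m → Ray m → Prop) (p q : ℝ) (Λ : Finset (V m)) :
    rcFin S p q Λ (oneCfg m) = rcFin (closureRel S) p q Λ (oneCfg m) := by
  have h : rcUnnorm S p q Λ (oneCfg m) = rcUnnorm (closureRel S) p q Λ (oneCfg m) := by
    unfold rcUnnorm rcWeight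
    congr 1
    funext ω
    rw [kCount_closureRel S ω.2]
  rw [rcFin, rcFin, h]

/-- For an arbitrary equivalence relation `∼` on the rays of `T'_m`,
`q ≥ 1` and `p ∈ [0,1]`, the finite-volume measures `φ^{1,∼}_{Λ,p,q}` converge weakly,
as `Λ ↑ V`, to the measure `φ^{1,ol∼}_{p,q}` associated with the closure `ol∼` of `∼`. -/
theorem weak_limit_closure (m : ℕ) (hm : 2 ≤ m) (S : Ray m → Ray m → Prop)
    (hequiv : Equivalence S)
    (p q : ℝ) (hp0 : 0 ≤ p) (hp1 : p ≤ 1) (hq : 1 ≤ q)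
    (φ : Measure (Config m)) (hprob : IsProbabilityMeasure φ)
    (hφ : WeakLim (fun Λ => rcFin (closureRel S) p q Λ (oneCfg m)) φ) :
    WeakLim (fun Λ => rcFin S p q Λ (oneCfg m)) φ := by
  simpa only [rcFin_closureRel S] using hφ

end RCTree
end
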